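/- Let $T=I_1\times\dots\times I_d\subset\mathbb R^d$ be a product of (possibly unbounded) one-dimensional intervals. For an integer $k\ge 0$ and $\gamma\in(0,1]$, and for $S$ a product of intervals, let $C^{k,\gamma}(S;\mathbb R)$ be the space of functions $f:S\to\mathbb R$ that are $k$ times continuously differentiable on $S$ (derivatives taken relative to $S$) and whose $k$-th derivative is locally $\gamma$-Hölder continuous, i.e. $\gamma$-Hölder continuous on some neighbourhood in $S$ of each point of $S$. Let $k,l\ge 0$ be integers and $\gamma,\eta,\delta\in(0,1]$. (1) Let $X=(X_t)_{t\in T}$ be a real stochastic process with sample paths almost surely in $C^{k,\gamma}(T;\mathbb R)$, let $F_{X_t}$ be the cumulative distribution function of $X_t$, and suppose that $(t,x)\mapsto F_{X_t}(x)$ belongs to $C^{l,\eta}(T\times\mathbb R;\mathbb R)$. Then the associated copula process $U$, defined by $U_t=F_{X_t}(X_t)$, has sample paths almost surely in $$\begin{cases} C^{0,\gamma\eta}(T;\mathbb R) & k=l=0,\\ C^{l,\eta}(T;\mathbb R) & k>l,\\ C^{k,\gamma}(T;\mathbb R) & l>k,\\ C^{k,\min(\gamma,\eta)}(T;\mathbb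 R) & k=l\ge 1.\end{cases}$$ (2) Conversely, let $U=(U_t)_{t\in T}$ be a copula process, i.e. a process such that each $U_t$ is uniformly distributed on $[0,1]$, whose sample paths almost surely take values in $(0,1)$ and belong to $C^{k,\gamma}(T;\mathbb R)$. Let $(G_t)_{t\in T}$ be cumulative distribution functions on $\mathbb R$ with quantile functions $G_t^{[-1]}(u)=\inf\{x\in\mathbb R: G_t(x)\ge u\}$, and suppose that $(t,u)\mapsto G_t^{[-1]}(u)$ belongs to $C^{l,\delta}(T\times(0,1);\mathbb R)$. Then the process $Y$ defined by $Y_t=G_t^{[-1]}(U_t)$ has sample paths almost surely in $$\begin{cases} C^{0,\gamma\delta}(T;\mathbb R) & k=l=0,\\ C^{l,\delta}(T;\mathbb R) & k>l,\\ C^{k,\gamma}(T;\mathbb R) & l>k,\\ C^{k,\min(\gamma,\delta)}(T;\mathbb R) & k=l\ge 1.\end{cases}$$ -/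

import Mathlib

open MeasureTheory ProbabilityTheory
open scoped NNReal

/-- `f` is locally `γ`-Hölder continuous on `s`: every point of `s` has a neighbourhood
within `s` on which `f` is Hölder continuous of exponent `γ` with some constant. -/
def LocHolderOn {E F : Type*} [NormedAddCommGroup E] [NormedAddCommGroup F]
    (γ : ℝ≥0) (f : E → F) (s : Set E) : Prop :=
  ∀ x ∈ s, ∃ u ∈ nhdsWithin x s, ∃ K : ℝ≥0, HolderOnWith K γ f u

/-- `f` belongs to the local Hölder space `C^{k,γ}(s)`: `f` has continuous derivatives
`p 0 = f, p 1, …, p k` on `s` (taken within `s`), and the `k`-th one is locally `γ`-Hölder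
continuous on `s`. Where derivatives within `s` are unique, this is
`memCkHolder_iff_of_uniqueDiffOn`; the existential form is also meaningful when one of
the sides of a box `s` is a single point. -/
def MemCkHolder {E F : Type*} [NormedAddCommGroup E] [NormedSpace ℝ E]
    [NormedAddCommGroup F] [NormedSpace ℝ F] (k : ℕ) (γ : ℝ≥0) (s : Set E) (f : E → F) :
    Prop :=
  ∃ p : E → FormalMultilinearSeries ℝ E F,
    HasFTaylorSeriesUpToOn k f p s ∧ LocHolderOn γ (fun x => p x k) s

theorem LocHolderOn.congr {E F : Type*} [NormedAddCommGroup E] [NormedAddCommGroup F]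
    {γ : ℝ≥0} {f g : E → F} {s : Set E} (hf : LocHolderOn γ f s)
    (h : ∀ x ∈ s, g x = f x) : LocHolderOn γ g s := by
  intro x hx
  obtain ⟨u, hu, K, hK⟩ := hf x hx
  refine ⟨u ∩ s, Filter.inter_mem hu self_mem_nhdsWithin, K, ?_⟩
  intro y hy z hz
  rw [h y hy.2, h z hz.2]
  exact hK y hy.1 z hz.1

theorem memCkHolder_iff_of_uniqueDiffOn {E F : Type*} [NormedAddCommGroup E]
    [NormedSpace ℝ E] [NormedAddCommGroup F] [NormedSpace ℝ F] {k : ℕ} {γ : ℝ≥0}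
    {s : Set E} {f : E → F} (hs : UniqueDiffOn ℝ s) :
    MemCkHolder k γ s f ↔
      ContDiffOn ℝ k f s ∧ LocHolderOn γ (iteratedFDerivWithin ℝ k f s) s := by
  constructor
  · rintro ⟨p, hp, hγ⟩
    exact ⟨hp.contDiffOn, hγ.congr fun x hx =>
      (hp.eq_iteratedFDerivWithin_of_uniqueDiffOn le_rfl hs hx).symm⟩
  · rintro ⟨hf, hγ⟩
    exact ⟨ftaylorSeriesWithin ℝ f s, hf.ftaylorSeriesWithin hs, hγ⟩

/-- The box `I_1 × … × I_d` in `ℝ^d`. -/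
def boxOf {d : ℕ} (I : Fin d → Set ℝ) : Set (EuclideanSpace ℝ (Fin d)) :=
  {t | ∀ i, t i ∈ I i}

/-- A one-dimensional cumulative distribution function: monotone, right-continuous,
with limits `0` at `-∞` and `1` at `+∞`. -/
def IsCDFFun (F : ℝ → ℝ) : Prop :=
  Monotone F ∧ (∀ x, ContinuousWithinAt F (Set.Ici x) x) ∧
    Filter.Tendsto F Filter.atBot (nhds 0) ∧ Filter.Tendsto F Filter.atTop (nhds 1)

/-- The quantile function `G^{[-1]}(u) = inf {x : G(x) ≥ u}`. For a cdf `G` and `u ∈ (0,1)`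
the set is nonempty and bounded below. -/
noncomputable def quantileOf (G : ℝ → ℝ) (u : ℝ) : ℝ := sInf {x : ℝ | u ≤ G x}

/-- `(U_t)_{t ∈ T}` is a copula process: each `U_t`, `t ∈ T`, is a random variable that is
uniformly distributed on `[0,1]`. -/
def IsCopulaProcess {Ω ι : Type*} [MeasurableSpace Ω] (P : Measure Ω) (T : Set ι)
    (U : ι → Ω → ℝ) : Prop :=
  ∀ t ∈ T, Measurable (U t) ∧
    P.map (U t) = (volume : Measure ℝ).restrict (Set.Icc 0 1)

namespace LocHolderOn

variable {E F G : Type*} [NormedAddCommGroup E] [NormedAddCommGroup F] [NormedAddCommGroup G]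
  {α β γ : ℝ≥0} {f : E → F} {s : Set E}

theorem continuousOn (hf : LocHolderOn γ f s) (hγ : 0 < γ) : ContinuousOn f s := by
  intro x hx
  obtain ⟨u, hu, K, hK⟩ := hf x hx
  exact (hK.continuousOn hγ x (mem_of_mem_nhdsWithin hx hu)).mono_of_mem_nhdsWithin hu

/-- Lowering the exponent preserves local Hölder continuity. -/
theorem of_le (hf : LocHolderOn γ f s) (h : β ≤ γ) : LocHolderOn β f s := by
  intro x hx
  obtain ⟨u, hu, K, hK⟩ := hf x hx
  refine ⟨u ∩ Metric.ball x 1, Filter.inter_mem hu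
    (mem_nhdsWithin_of_mem_nhds (Metric.ball_mem_nhds x one_pos)), _,
    HolderOnWith.of_le (D := 2) ?_ (hK.mono Set.inter_subset_left) h⟩
  intro y hy z hz
  rw [edist_dist]
  refine ENNReal.ofReal_le_of_le_toReal ?_
  have h₁ := Metric.mem_ball.1 hy.2
  have h₂ := Metric.mem_ball.1 hz.2
  have h₃ := dist_triangle_right y z x
  simp only [ENNReal.coe_ofNat, ENNReal.toReal_ofNat]
  linarith

theorem comp {g : F → G} {t : Set F} (hg : LocHolderOn α g t) (hf : LocHolderOn β f s)
    (hβ : 0 < β) (h : Set.MapsTo f s t) : LocHolderOn (α * β) (fun x => g (f x)) s := by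
  intro x hx
  obtain ⟨v, hv, K, hK⟩ := hg (f x) (h hx)
  obtain ⟨u, hu, L, hL⟩ := hf x hx
  have hpre : f ⁻¹' v ∈ nhdsWithin x s :=
    ((hf.continuousOn hβ x hx).tendsto_nhdsWithin h) hv
  exact ⟨u ∩ f ⁻¹' v, Filter.inter_mem hu hpre, _,
    hK.comp (hL.mono Set.inter_subset_left) fun y hy => hy.2⟩

theorem prodMk {g : E → G} (hf : LocHolderOn γ f s) (hg : LocHolderOn γ g s) :
    LocHolderOn γ (fun x => (f x, g x)) s := by
  intro x hx
  obtain ⟨u, hu, K, hK⟩ := hf x hx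
  obtain ⟨v, hv, L, hL⟩ := hg x hx
  refine ⟨u ∩ v, Filter.inter_mem hu hv, max K L, fun y hy z hz => ?_⟩
  rw [Prod.edist_eq]
  exact max_le ((hK.mono_const (le_max_left K L)) y hy.1 z hz.1)
    ((hL.mono_const (le_max_right K L)) y hy.2 z hz.2)

theorem pi {ι : Type*} [Fintype ι] {H : ι → Type*} [∀ i, NormedAddCommGroup (H i)]
    {f : ∀ i, E → H i} (hf : ∀ i, LocHolderOn γ (f i) s) :
    LocHolderOn γ (fun x i => f i x) s := by
  intro x hx
  choose u hu K hK using fun i => hf i x hx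
  refine ⟨⋂ i, u i, Filter.iInter_mem.2 hu, ∑ i, K i, fun y hy z hz => ?_⟩
  refine edist_pi_le_iff.2 fun i => ?_
  exact ((hK i).mono_const (Finset.single_le_sum (fun _ _ => zero_le) (Finset.mem_univ i)))
    y (Set.mem_iInter.1 hy i) z (Set.mem_iInter.1 hz i)

end LocHolderOn

theorem LocallyLipschitzOn.locHolderOn_one {E F : Type*} [NormedAddCommGroup E]
    [NormedAddCommGroup F] {f : E → F} {s : Set E} (hf : LocallyLipschitzOn s f) :
    LocHolderOn 1 f s := by
  intro x hx
  obtain ⟨K, u, hu, hK⟩ := hf hx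
  exact ⟨u, hu, K, hK.holderOnWith⟩

section

variable {E F G : Type*} [NormedAddCommGroup E] [NormedSpace ℝ E] [NormedAddCommGroup F]
  [NormedSpace ℝ F] [NormedAddCommGroup G] [NormedSpace ℝ G]

/-- Post-composition with a `C^1` map preserves local Hölder continuity. -/
theorem ContDiff.comp_locHolderOn {X : Type*} [NormedAddCommGroup X] {g : F → G}
    (hg : ContDiff ℝ 1 g) {f : X → F} {s : Set X}
    {γ : ℝ≥0} (hγ : 0 < γ) (hf : LocHolderOn γ f s) : LocHolderOn γ (fun x => g (f x)) s := by
  have h : LocHolderOn 1 g Set.univ :=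
    LocallyLipschitzOn.locHolderOn_one (hg.contDiffOn.locallyLipschitzOn convex_univ)
  simpa using h.comp hf hγ (Set.mapsTo_univ f s)

theorem LocHolderOn.sum {X ι : Type*} [NormedAddCommGroup X] [Fintype ι] {f : ι → X → F}
    {s : Set X} {γ : ℝ≥0}
    (hγ : 0 < γ) (hf : ∀ i, LocHolderOn γ (f i) s) : LocHolderOn γ (fun x => ∑ i, f i x) s :=
  ContDiff.comp_locHolderOn (g := fun y : ι → F => ∑ i, y i) (by fun_prop) hγ (.pi hf)

namespace HasFTaylorSeriesUpToOn

/-- On a convex set, every term of a Taylor series except the last is locally Lipschitz. -/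
theorem locHolderOn_one {k j : ℕ} {f : E → F} {p : E → FormalMultilinearSeries ℝ E F}
    {s : Set E} (hs : Convex ℝ s) (hp : HasFTaylorSeriesUpToOn k f p s) (hj : j < k) :
    LocHolderOn 1 (fun x => p x j) s := by
  refine LocallyLipschitzOn.locHolderOn_one (ContDiffOn.locallyLipschitzOn hs ?_)
  have hcont : ContinuousOn (fun x => (p x j.succ).curryLeft) s :=
    (continuousMultilinearCurryLeftEquiv ℝ (fun _ : Fin j.succ => E) F).continuous.comp_continuousOn
      (hp.cont j.succ (by exact_mod_cast hj))
  have hder := hp.fderivWithin j (by exact_mod_cast hj)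
  intro x hx
  refine (contDiffWithinAt_succ_iff_hasFDerivWithinAt (n := 0) (by simp)).2
    ⟨s, by rw [Set.insert_eq_of_mem hx]; exact self_mem_nhdsWithin, by simp, _, hder, ?_⟩
  exact contDiffOn_zero.2 hcont x hx

/-- Terms of order at most `k` of a Taylor series whose `k`-th term is locally `γ`-Hölder. -/
theorem locHolderOn_of_le {k j : ℕ} {γ ρ : ℝ≥0} {f : E → F}
    {p : E → FormalMultilinearSeries ℝ E F} {s : Set E} (hs : Convex ℝ s)
    (hp : HasFTaylorSeriesUpToOn k f p s) (hγ : LocHolderOn γ (fun x => p x k) s) (hj : j ≤ k)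
    (hρ : ρ ≤ 1) (hργ : j = k → ρ ≤ γ) : LocHolderOn ρ (fun x => p x j) s := by
  rcases hj.lt_or_eq with h | rfl
  · exact (hp.locHolderOn_one hs h).of_le hρ
  · exact hγ.of_le (hργ rfl)

theorem locHolderOn_self {n : ℕ} {γ : ℝ≥0} {f : E → F} {p : E → FormalMultilinearSeries ℝ E F}
    {s : Set E} (hγ : 0 < γ) (hp : HasFTaylorSeriesUpToOn n f p s)
    (h : LocHolderOn γ (fun x => p x 0) s) : LocHolderOn γ f s :=
  LocHolderOn.congr (ContDiff.comp_locHolderOn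
    (g := continuousMultilinearCurryFin0 ℝ E F)
    (continuousMultilinearCurryFin0 ℝ E F).contDiff hγ h) fun x hx => (hp.zero_eq x hx).symm

end HasFTaylorSeriesUpToOn

/-- Faà di Bruno's formula preserves local Hölder continuity of the coefficients. -/
theorem LocHolderOn.taylorComp {n : ℕ} {ρ : ℝ≥0} (hρ : 0 < ρ)
    {q : E → FormalMultilinearSeries ℝ F G} {p : E → FormalMultilinearSeries ℝ E F} {s : Set E}
    (hq : ∀ j ≤ n, LocHolderOn ρ (fun x => q x j) s)
    (hp : ∀ j, 1 ≤ j → j ≤ n → LocHolderOn ρ (fun x => p x j) s) :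
    LocHolderOn ρ (fun x => (q x).taylorComp (p x) n) s := by
  have key : ∀ c : OrderedFinpartition n,
      LocHolderOn ρ (fun x => (q x).compAlongOrderedFinpartition (p x) c) s := by
    intro c
    have hB : ContDiff ℝ 1 fun z : (F [×c.length]→L[ℝ] G) ×
        (∀ i, E [×c.partSize i]→L[ℝ] F) => c.compAlongOrderedFinpartitionL ℝ E F G z.1 z.2 :=
      contDiffOn_univ.1 ((c.compAlongOrderedFinpartitionL ℝ E F
        G).analyticOnNhd_uncurry_of_multilinear.contDiffOn uniqueDiffOn_univ)
    have hcoeff : LocHolderOn ρ (fun x => (q x c.length, fun i => p x (c.partSize i))) s :=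
      (hq c.length c.length_le).prodMk
        (.pi fun i => hp _ (c.partSize_pos i) (c.partSize_le i))
    have hcomp := hB.comp_locHolderOn hρ hcoeff
    exact hcomp.congr fun x _ => rfl
  exact LocHolderOn.sum hρ key

/-- Local Hölder regularity of `x ↦ g (x, f x)`: the `n`-th derivative is a polynomial in the
derivatives of `g` along the graph of `f`, Hölder of exponent `α * β`, and those of `f`. -/
theorem MemCkHolder.comp_graph {s : Set E} {t : Set F} (hs : Convex ℝ s) (ht : Convex ℝ t)
    {n k l : ℕ} {γ η α β ρ : ℝ≥0} {f : E → F} {g : E × F → G}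
    (hf : MemCkHolder k γ s f) (hg : MemCkHolder l η (s ×ˢ t) g) (hst : Set.MapsTo f s t)
    (hnk : n ≤ k) (hnl : n ≤ l) (hβ : 0 < β) (hβ₁ : β ≤ 1) (hβγ : k = 0 → β ≤ γ)
    (hα₁ : α ≤ 1) (hαη : n = l → α ≤ η) (hρ : 0 < ρ) (hραβ : ρ ≤ α * β)
    (hργ : n = k → ρ ≤ γ) : MemCkHolder n ρ s fun x => g (x, f x) := by
  obtain ⟨p, hp, hpγ⟩ := hf
  obtain ⟨q, hq, hqη⟩ := hg
  have hρ₁ : ρ ≤ 1 := hραβ.trans (mul_le_one' hα₁ hβ₁)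
  have hid : HasFTaylorSeriesUpToOn (n + 1 : ℕ) (id : E → E) (ftaylorSeries ℝ id) s :=
    (contDiff_iff_ftaylorSeries.1 contDiff_id).hasFTaylorSeriesUpToOn s
  have hfβ : LocHolderOn β f s := hp.locHolderOn_self hβ
    (hp.locHolderOn_of_le hs hpγ (Nat.zero_le k) hβ₁ fun h => hβγ h.symm)
  have hidβ : LocHolderOn β (id : E → E) s :=
    (LocallyLipschitzOn.locHolderOn_one
      (contDiff_id.contDiffOn.locallyLipschitzOn hs)).of_le hβ₁
  have hgraph : LocHolderOn β (fun x => (x, f x)) s := hidβ.prodMk hfβ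
  have hmaps : Set.MapsTo (fun x => (x, f x)) s (s ×ˢ t) := fun x hx => ⟨hx, hst hx⟩
  have hn : ((n : ℕ) : WithTop ℕ∞) ≤ (n + 1 : ℕ) := by exact_mod_cast n.le_succ
  have hnk' : ((n : ℕ) : WithTop ℕ∞) ≤ k := by exact_mod_cast hnk
  have hnl' : ((n : ℕ) : WithTop ℕ∞) ≤ l := by exact_mod_cast hnl
  refine ⟨_, (hq.of_le hnl').comp ((hid.of_le hn).prodMk (hp.of_le hnk')) hmaps, ?_⟩
  refine LocHolderOn.taylorComp hρ (fun j hj => ?_) fun j _ hj => ?_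
  · exact ((hq.locHolderOn_of_le (hs.prod ht) hqη (hj.trans hnl) hα₁ fun h =>
      hαη (le_antisymm hnl (h ▸ hj))).comp hgraph hβ hmaps).of_le hραβ
  · have hcoeff : LocHolderOn ρ (fun x => (ftaylorSeries ℝ (id : E → E) x j, p x j)) s :=
      ((hid.locHolderOn_one hs (Nat.lt_succ_of_le hj)).of_le hρ₁).prodMk
        (hp.locHolderOn_of_le hs hpγ (hj.trans hnk) hρ₁ fun h =>
          hργ (le_antisymm hnk (h ▸ hj)))
    have hprod : ContDiff ℝ 1
        (ContinuousMultilinearMap.prodL ℝ (fun _ : Fin j => E) E F) :=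
      (ContinuousMultilinearMap.prodL ℝ (fun _ : Fin j => E) E F).toContinuousLinearEquiv.contDiff
    have hcomp := hprod.comp_locHolderOn hρ hcoeff
    exact hcomp.congr fun x _ => rfl

theorem MemCkHolder.congr {k : ℕ} {γ : ℝ≥0} {s : Set E} {f g : E → F}
    (hf : MemCkHolder k γ s f) (h : ∀ x ∈ s, g x = f x) : MemCkHolder k γ s g := by
  obtain ⟨p, hp, hγ⟩ := hf
  exact ⟨p, hp.congr h, hγ⟩

/-- The four regimes for the regularity of `x ↦ g (x, f x)`. -/
theorem MemCkHolder.comp_graph_cases {s : Set E} {t : Set F} (hs : Convex ℝ s)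
    (ht : Convex ℝ t) {k l : ℕ} {γ η : ℝ≥0} (hγ : 0 < γ) (hγ₁ : γ ≤ 1) (hη : 0 < η)
    (hη₁ : η ≤ 1) {f : E → F} {g : E × F → G} (hf : MemCkHolder k γ s f)
    (hg : MemCkHolder l η (s ×ˢ t) g) (hst : Set.MapsTo f s t) :
    (k = 0 → l = 0 → MemCkHolder 0 (γ * η) s fun x => g (x, f x)) ∧
    (l < k → MemCkHolder l η s fun x => g (x, f x)) ∧
    (k < l → MemCkHolder k γ s fun x => g (x, f x)) ∧
    (k = l → 1 ≤ k → MemCkHolder k (min γ η) s fun x => g (x, f x)) := by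
  refine ⟨?_, fun h => ?_, fun h => ?_, ?_⟩
  · rintro rfl rfl
    exact hf.comp_graph hs ht hg hst le_rfl le_rfl hγ hγ₁ (fun _ => le_rfl) hη₁ (fun _ => le_rfl)
      (mul_pos hγ hη) (mul_comm γ η).le fun _ => mul_le_of_le_one_right' hη₁
  · exact hf.comp_graph hs ht hg hst h.le le_rfl one_pos le_rfl (fun h₀ => by omega) hη₁
      (fun _ => le_rfl) hη (mul_one η).ge fun h₀ => by omega
  · exact hf.comp_graph hs ht hg hst le_rfl h.le hγ hγ₁ (fun _ => le_rfl) le_rfl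
      (fun h₀ => by omega) hγ (one_mul γ).ge fun _ => le_rfl
  · rintro rfl h
    exact hf.comp_graph hs ht hg hst le_rfl le_rfl one_pos le_rfl (fun h₀ => by omega) hη₁
      (fun _ => le_rfl) (lt_min hγ hη) (by rw [mul_one]; exact min_le_right γ η)
      fun _ => min_le_left γ η

end

theorem convex_boxOf {d : ℕ} {I : Fin d → Set ℝ} (hI : ∀ i, (I i).OrdConnected) :
    Convex ℝ (boxOf I) := by
  intro x hx y hy a b ha hb hab i
  exact (hI i).convex (hx i) (hy i) ha hb hab

/-- **Hölder regularity of copula constructions.**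
(1) If `X` has sample paths a.s. in `C^{k,γ}(T)` and `(t,x) ↦ F_{X_t}(x)` is in
`C^{l,η}(T × ℝ)`, then `U_t = F_{X_t}(X_t)` has sample paths a.s. in `C^{0,γη}(T)` if
`k = l = 0`, in `C^{l,η}(T)` if `k > l`, in `C^{k,γ}(T)` if `l > k`, and in
`C^{k,min(γ,η)}(T)` if `k = l ≥ 1`.
(2) If a copula process `U` has sample paths a.s. in `C^{k,γ}(T)` and with values in `(0,1)`,
and `(t,u) ↦ G_t^{[-1]}(u)` is in `C^{l,δ}(T × (0,1))`, then `Y_t = G_t^{[-1]}(U_t)` has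
sample paths a.s. in the corresponding space (with `δ` in place of `η`). -/
theorem holder_regularity_of_copula_construction
    {d : ℕ} (I : Fin d → Set ℝ) (hI : ∀ i, (I i).OrdConnected)
    (T : Set (EuclideanSpace ℝ (Fin d))) (hT : T = boxOf I)
    {Ω : Type*} [MeasurableSpace Ω] (P : Measure Ω) [IsProbabilityMeasure P] :
    (∀ (k l : ℕ) (γ η : ℝ≥0), 0 < γ → γ ≤ 1 → 0 < η → η ≤ 1 →
      ∀ X : EuclideanSpace ℝ (Fin d) → Ω → ℝ,
        (∀ t ∈ T, Measurable (X t)) →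
        (∀ᵐ ω ∂P, MemCkHolder k γ T (fun t => X t ω)) →
        MemCkHolder l η (T ×ˢ (Set.univ : Set ℝ))
          (fun q : EuclideanSpace ℝ (Fin d) × ℝ => cdf (P.map (X q.1)) q.2) →
        ∀ U : EuclideanSpace ℝ (Fin d) → Ω → ℝ,
          (∀ t ∈ T, ∀ ω, U t ω = cdf (P.map (X t)) (X t ω)) →
          (k = 0 → l = 0 → ∀ᵐ ω ∂P, MemCkHolder 0 (γ * η) T (fun t => U t ω)) ∧
          (l < k → ∀ᵐ ω ∂P, MemCkHolder l η T (fun t => U t ω)) ∧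
          (k < l → ∀ᵐ ω ∂P, MemCkHolder k γ T (fun t => U t ω)) ∧
          (k = l → 1 ≤ k → ∀ᵐ ω ∂P, MemCkHolder k (min γ η) T (fun t => U t ω))) ∧
    (∀ (k l : ℕ) (γ δ : ℝ≥0), 0 < γ → γ ≤ 1 → 0 < δ → δ ≤ 1 →
      ∀ U : EuclideanSpace ℝ (Fin d) → Ω → ℝ,
        IsCopulaProcess P T U →
        (∀ᵐ ω ∂P, ∀ t ∈ T, U t ω ∈ Set.Ioo (0 : ℝ) 1) →
        (∀ᵐ ω ∂P, MemCkHolder k γ T (fun t => U t ω)) →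
        ∀ G : EuclideanSpace ℝ (Fin d) → ℝ → ℝ,
          (∀ t ∈ T, IsCDFFun (G t)) →
          MemCkHolder l δ (T ×ˢ Set.Ioo (0 : ℝ) 1)
            (fun q : EuclideanSpace ℝ (Fin d) × ℝ => quantileOf (G q.1) q.2) →
          ∀ Y : EuclideanSpace ℝ (Fin d) → Ω → ℝ,
            (∀ t ∈ T, ∀ ω, Y t ω = quantileOf (G t) (U t ω)) →
            (k = 0 → l = 0 → ∀ᵐ ω ∂P, MemCkHolder 0 (γ * δ) T (fun t => Y t ω)) ∧
            (l < k → ∀ᵐ ω ∂P, MemCkHolder l δ T (fun t => Y t ω)) ∧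
            (k < l → ∀ᵐ ω ∂P, MemCkHolder k γ T (fun t => Y t ω)) ∧
            (k = l → 1 ≤ k → ∀ᵐ ω ∂P, MemCkHolder k (min γ δ) T (fun t => Y t ω))) := by
  have hconv : Convex ℝ T := hT ▸ convex_boxOf hI
  refine ⟨?_, ?_⟩
  · intro k l γ η hγ hγ₁ hη hη₁ X _ hX hF U hU
    have key := hX.mono fun ω hω =>
      hω.comp_graph_cases hconv convex_univ hγ hγ₁ hη hη₁ hF (Set.mapsTo_univ _ _)
    refine ⟨fun h₁ h₂ => ?_, fun h => ?_, fun h => ?_, fun h₁ h₂ => ?_⟩ <;>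
      filter_upwards [key] with ω hω
    · exact (hω.1 h₁ h₂).congr fun t ht => hU t ht ω
    · exact (hω.2.1 h).congr fun t ht => hU t ht ω
    · exact (hω.2.2.1 h).congr fun t ht => hU t ht ω
    · exact (hω.2.2.2 h₁ h₂).congr fun t ht => hU t ht ω
  · intro k l γ δ hγ hγ₁ hδ hδ₁ U _ hU₀₁ hU G _ hG Y hY
    have key := hU.and hU₀₁ |>.mono fun ω hω =>
      hω.1.comp_graph_cases hconv (convex_Ioo 0 1) hγ hγ₁ hδ hδ₁ hG hω.2
    refine ⟨fun h₁ h₂ => ?_, fun h => ?_, fun h => ?_, fun h₁ h₂ => ?_⟩ <;>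
      filter_upwards [key] with ω hω
    · exact (hω.1 h₁ h₂).congr fun t ht => hY t ht ω
    · exact (hω.2.1 h).congr fun t ht => hY t ht ω
    · exact (hω.2.2.1 h).congr fun t ht => hY t ht ω
    · exact (hω.2.2.2 h₁ h₂).congr fun t ht => hY t ht ω
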